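/- Let M, K, φ, T_m, N, K', ψ, T_n, m, n be natural numbers with K ≤ M, 1 ≤ φ ≤ M, 1 ≤ T_m ≤ φ, K' ≤ N, 1 ≤ ψ ≤ N, 1 ≤ T_n ≤ ψ, and m, n ≥ 1. Define s = K/M − (T_m−1)/φ and t = K'/N − (T_n−1)/ψ, and assume s ≥ 0 and t ≥ 0. Define P(ω_k) = ∏_{i=1}^m ∏_{j=1}^n [(∑_{α=0}^{T_m−1} C(K,α)·C(M−K, φ−α)/C(M,φ)) · (∑_{β=0}^{T_n−1} C(K',β)·C(N−K', ψ−β)/C(N,ψ))] (so the same factor appears m·n times). Then P(ω_k) ≤ exp(−2·(φ·m·s² + ψ·n·t²)). -/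

import Mathlib

open Finset MeasureTheory ProbabilityTheory

/-- Hoeffding's lemma for a Bernoulli variable with success probability `q`. -/
lemma one_sub_add_mul_exp_le {q : ℝ} (hq0 : 0 ≤ q) (hq1 : q ≤ 1) (u : ℝ) :
    1 - q + q * Real.exp u ≤ Real.exp (q * u + u ^ 2 / 8) := by
  let μ : Measure ℝ := ENNReal.ofReal (1 - q) • Measure.dirac 0 + ENNReal.ofReal q • Measure.dirac 1
  have integral_μ (f : ℝ → ℝ) : ∫ x, f x ∂μ = (1 - q) * f 0 + q * f 1 := by
    have hf (a : ℝ) : Integrable f (Measure.dirac a) := integrable_dirac (by simp)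
    rw [integral_add_measure ((hf 0).smul_measure (by simp)) ((hf 1).smul_measure (by simp)),
      integral_smul_measure, integral_smul_measure, integral_dirac, integral_dirac,
      ENNReal.toReal_ofReal (by linarith), ENNReal.toReal_ofReal hq0, smul_eq_mul, smul_eq_mul]
  have : IsProbabilityMeasure μ := ⟨by
    simp [μ, ← ENNReal.ofReal_add (sub_nonneg.2 hq1) hq0]⟩
  have hIcc : ∀ᵐ x ∂μ, id x ∈ Set.Icc (0 : ℝ) 1 := by
    refine ae_add_measure_iff.2 ⟨Measure.ae_smul_measure ?_ _, Measure.ae_smul_measure ?_ _⟩ <;>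
      simp [ae_dirac_eq]
  have h := (hasSubgaussianMGF_of_mem_Icc aemeasurable_id hIcc).mgf_le u
  rw [mgf, integral_μ, integral_μ] at h
  norm_num at h
  calc 1 - q + q * Real.exp u
      = Real.exp (q * u) * ((1 - q) * Real.exp (-(u * q)) + q * Real.exp (u * (1 - q))) := by
        rw [mul_add, mul_left_comm, mul_left_comm _ q, ← Real.exp_add, ← Real.exp_add,
          show q * u + -(u * q) = 0 by ring, show q * u + u * (1 - q) = u by ring,
          Real.exp_zero, mul_one]
    _ ≤ _ := by
        rw [Real.exp_add]
        gcongr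
        rwa [show u ^ 2 / 8 = 1 / 4 * u ^ 2 / 2 by ring]

lemma choose_mul_pow_le {L M : ℕ} (h : L ≤ M) (j : ℕ) :
    L.choose j * M ^ j ≤ M.choose j * L ^ j := by
  have key : L.descFactorial j * M ^ j ≤ M.descFactorial j * L ^ j := by
    induction j with
    | zero => simp
    | succ j ih =>
      have hstep : (L - j) * M ≤ (M - j) * L := by
        rw [Nat.sub_mul, Nat.sub_mul, mul_comm L M]
        exact Nat.sub_le_sub_left (Nat.mul_le_mul_left j h) _
      calc L.descFactorial (j + 1) * M ^ (j + 1)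
          = (L - j) * M * (L.descFactorial j * M ^ j) := by
            rw [Nat.descFactorial_succ, pow_succ]; ring
        _ ≤ (M - j) * L * (M.descFactorial j * L ^ j) := Nat.mul_le_mul hstep ih
        _ = M.descFactorial (j + 1) * L ^ (j + 1) := by
            rw [Nat.descFactorial_succ, pow_succ]; ring
  rw [Nat.descFactorial_eq_factorial_mul_choose, Nat.descFactorial_eq_factorial_mul_choose,
    mul_assoc, mul_assoc] at key
  exact Nat.le_of_mul_le_mul_left key j.factorial_pos

lemma sum_choose_mul_choose_mul_choose (L K : ℕ) {r j : ℕ} (hj : j ≤ r) :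
    ∑ b ∈ range (r + 1), L.choose b * K.choose (r - b) * b.choose j =
      L.choose j * (L + K - j).choose (r - j) := by
  rcases lt_or_ge L j with hL | hL
  · rw [Nat.choose_eq_zero_of_lt hL, zero_mul]
    refine sum_eq_zero fun b _ ↦ ?_
    rcases lt_or_ge L b with hb | hb
    · simp [Nat.choose_eq_zero_of_lt hb]
    · simp [Nat.choose_eq_zero_of_lt (hb.trans_lt hL)]
  · obtain ⟨i, rfl⟩ := Nat.exists_eq_add_of_le hj
    rw [add_assoc, sum_range_add, sum_eq_zero, zero_add,
      show L + K - j = (L - j) + K by lia, add_tsub_cancel_left, Nat.add_choose_eq,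
      Nat.sum_antidiagonal_eq_sum_range_succ_mk, mul_sum]
    · refine sum_congr rfl fun c _ ↦ ?_
      have h := Nat.choose_mul (n := L) (k := j + c) (s := j) (Nat.le_add_right j c)
      rw [add_tsub_cancel_left] at h
      rw [Nat.add_sub_add_left, mul_right_comm, h, mul_assoc]
    · intro b hb
      rw [Nat.choose_eq_zero_of_lt (mem_range.1 hb), mul_zero]

/-- The probability generating function of a hypergeometric variable is dominated, at arguments
at least one, by that of the binomial variable with the same mean. -/
lemma sum_choose_mul_choose_mul_pow_le {L K r : ℕ} (hM : 0 < L + K) {z : ℝ}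
    (hz : 1 ≤ z) :
    ∑ b ∈ range (r + 1), (L.choose b : ℝ) * K.choose (r - b) * z ^ b ≤
      (L + K).choose r * (1 - (L : ℝ) / (L + K : ℕ) + (L : ℝ) / (L + K : ℕ) * z) ^ r := by
  have hexp (b : ℕ) (hb : b ∈ range (r + 1)) :
      z ^ b = ∑ j ∈ range (r + 1), (b.choose j : ℝ) * (z - 1) ^ j := by
    conv_lhs => rw [← sub_add_cancel z 1, add_pow]
    refine sum_subset_zero_on_sdiff (range_mono (by simpa using hb)) ?_ ?_
    · intro j hj
      rw [Nat.choose_eq_zero_of_lt (by simp at hj; lia), Nat.cast_zero, zero_mul]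
    · intro j _
      simp [mul_comm]
  calc ∑ b ∈ range (r + 1), (L.choose b : ℝ) * K.choose (r - b) * z ^ b
      = ∑ j ∈ range (r + 1), ((∑ b ∈ range (r + 1),
          L.choose b * K.choose (r - b) * b.choose j : ℕ) : ℝ) * (z - 1) ^ j := by
        simp_rw [Nat.cast_sum, sum_mul]
        rw [sum_comm]
        refine sum_congr rfl fun b hb ↦ ?_
        rw [hexp b hb, mul_sum]
        refine sum_congr rfl fun j _ ↦ ?_
        push_cast
        ring
    _ ≤ ∑ j ∈ range (r + 1), ((L + K).choose r * r.choose j : ℝ) *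
          ((L : ℝ) / (L + K : ℕ)) ^ j * (z - 1) ^ j := by
        refine sum_le_sum fun j hj ↦ ?_
        have hjr : j ≤ r := Nat.lt_succ_iff.1 (mem_range.1 hj)
        refine mul_le_mul_of_nonneg_right ?_ (pow_nonneg (sub_nonneg.2 hz) j)
        rw [sum_choose_mul_choose_mul_choose L K hjr, ← Nat.cast_mul, Nat.choose_mul hjr,
          div_pow, ← mul_div_assoc, le_div_iff₀ (by positivity)]
        have h := Nat.mul_le_mul_right ((L + K - j).choose (r - j))
          (choose_mul_pow_le (Nat.le_add_right L K) j)
        have h' : (L.choose j * (L + K - j).choose (r - j)) * (L + K) ^ j ≤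
            ((L + K).choose j * (L + K - j).choose (r - j)) * L ^ j := by
          linarith
        exact_mod_cast h'
    _ = (L + K).choose r * (1 - (L : ℝ) / (L + K : ℕ) + (L : ℝ) / (L + K : ℕ) * z) ^ r := by
        rw [show 1 - (L : ℝ) / (L + K : ℕ) + (L : ℝ) / (L + K : ℕ) * z =
          (L : ℝ) / (L + K : ℕ) * (z - 1) + 1 by ring, add_pow, mul_sum]
        refine sum_congr rfl fun j _ ↦ ?_
        rw [one_pow, mul_pow]
        ring

/-- Hoeffding's bound for the lower tail of the hypergeometric distribution. -/
lemma sum_hypergeometric_le_exp {M K r T : ℕ} (hKM : K ≤ M) (hr : 1 ≤ r) (hrM : r ≤ M)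
    (hTr : T ≤ r) {s : ℝ} (hs : s = (K : ℝ) / M - ((T : ℝ) - 1) / r) (hs0 : 0 ≤ s) :
    ∑ a ∈ range T, ((K.choose a : ℝ) * ((M - K).choose (r - a) : ℝ)) / (M.choose r : ℝ) ≤
      Real.exp (-2 * (r * s ^ 2)) := by
  have hM : (0 : ℝ) < M := by exact_mod_cast hr.trans hrM
  have hr0 : (0 : ℝ) < r := by exact_mod_cast hr
  obtain ⟨L, rfl⟩ := Nat.exists_eq_add_of_le' hKM
  rw [Nat.add_sub_cancel, ← sum_div, div_le_iff₀ (by exact_mod_cast Nat.choose_pos hrM)]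
  set q : ℝ := (L : ℝ) / (L + K : ℕ) with hq
  have hKq : (K : ℝ) / (L + K : ℕ) = 1 - q := by
    rw [hq, eq_sub_iff_add_eq, ← add_div, div_eq_one_iff_eq hM.ne']
    push_cast
    ring
  have hT : (T : ℝ) - 1 = r * (1 - q - s) := by
    rw [hs, hKq]
    field_simp
    ring
  have hq0 : 0 ≤ q := by positivity
  have hq1 : q ≤ 1 := by
    have : 0 ≤ (K : ℝ) / (L + K : ℕ) := by positivity
    linarith
  set c : ℝ := Real.exp (-(4 * s * (r * (q + s)))) with hc
  calc ∑ a ∈ range T, (K.choose a : ℝ) * (L.choose (r - a) : ℝ)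
      ≤ ∑ a ∈ range T, c * ((L.choose (r - a) : ℝ) * K.choose a * Real.exp (4 * s) ^ (r - a)) := by
        refine sum_le_sum fun a ha ↦ ?_
        have haT : a + 1 ≤ T := mem_range.1 ha
        have haT' : (a : ℝ) + 1 ≤ T := by exact_mod_cast haT
        have hone : 1 ≤ c * Real.exp (4 * s) ^ (r - a) := by
          rw [hc, ← Real.exp_nat_mul, ← Real.exp_add, Nat.cast_sub (by lia)]
          refine Real.one_le_exp ?_
          have : 0 ≤ 4 * s * ((r : ℝ) - a - r * (q + s)) :=
            mul_nonneg (by linarith) (by linarith)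
          linarith
        calc (K.choose a : ℝ) * (L.choose (r - a) : ℝ)
            ≤ (K.choose a : ℝ) * (L.choose (r - a) : ℝ) * (c * Real.exp (4 * s) ^ (r - a)) :=
              le_mul_of_one_le_right (by positivity) hone
          _ = _ := by ring
    _ ≤ ∑ a ∈ range (r + 1),
          c * ((L.choose (r - a) : ℝ) * K.choose a * Real.exp (4 * s) ^ (r - a)) :=
        sum_le_sum_of_subset_of_nonneg (range_mono (by lia)) fun a _ _ ↦ by positivity
    _ = c * ∑ b ∈ range (r + 1), (L.choose b : ℝ) * K.choose (r - b) * Real.exp (4 * s) ^ b := by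
        rw [← mul_sum, ← sum_range_reflect]
        congr 1
        refine sum_congr rfl fun b hb ↦ ?_
        have hbr : b ≤ r := Nat.lt_succ_iff.1 (mem_range.1 hb)
        rw [show r + 1 - 1 - b = r - b by lia, Nat.sub_sub_self hbr]
    _ ≤ c * ((L + K).choose r * (1 - q + q * Real.exp (4 * s)) ^ r) := by
        gcongr
        exact sum_choose_mul_choose_mul_pow_le (by lia) (Real.one_le_exp (by linarith))
    _ ≤ c * ((L + K).choose r * Real.exp (q * (4 * s) + (4 * s) ^ 2 / 8) ^ r) := by
        have : 0 ≤ 1 - q + q * Real.exp (4 * s) :=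
          add_nonneg (by linarith) (by positivity)
        gcongr
        exact one_sub_add_mul_exp_le hq0 hq1 _
    _ = Real.exp (-2 * (r * s ^ 2)) * (L + K).choose r := by
        rw [mul_left_comm, hc, ← Real.exp_nat_mul, ← Real.exp_add, mul_comm]
        ring_nf

theorem miss_prob_all_blocks_le_exp
    (M K φ Tm N K' ψ Tn m n : ℕ)
    (hKM : K ≤ M) (hφ1 : 1 ≤ φ) (hφM : φ ≤ M) (hTm1 : 1 ≤ Tm) (hTmφ : Tm ≤ φ)
    (hK'N : K' ≤ N) (hψ1 : 1 ≤ ψ) (hψN : ψ ≤ N) (hTn1 : 1 ≤ Tn) (hTnψ : Tn ≤ ψ)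
    (hm : 1 ≤ m) (hn : 1 ≤ n)
    (s t : ℝ)
    (hs : s = (K : ℝ) / M - ((Tm : ℝ) - 1) / φ)
    (ht : t = (K' : ℝ) / N - ((Tn : ℝ) - 1) / ψ)
    (hs0 : 0 ≤ s) (ht0 : 0 ≤ t)
    (Pωk : ℝ)
    (hP : Pωk = ∏ _i ∈ Finset.range m, ∏ _j ∈ Finset.range n,
        ((∑ α ∈ Finset.range Tm,
            ((K.choose α : ℝ) * ((M - K).choose (φ - α) : ℝ)) / (M.choose φ : ℝ)) *
         (∑ β ∈ Finset.range Tn,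
            ((K'.choose β : ℝ) * ((N - K').choose (ψ - β) : ℝ)) / (N.choose ψ : ℝ)))) :
    Pωk ≤ Real.exp (-2 * ((φ : ℝ) * m * s ^ 2 + (ψ : ℝ) * n * t ^ 2)) := by
  have hrow := sum_hypergeometric_le_exp hKM hφ1 hφM hTmφ hs hs0
  have hcol := sum_hypergeometric_le_exp hK'N hψ1 hψN hTnψ ht ht0
  have hm' : (1 : ℝ) ≤ m := by exact_mod_cast hm
  have hn' : (1 : ℝ) ≤ n := by exact_mod_cast hn
  simp only [prod_const, card_range, ← pow_mul] at hP
  rw [hP]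
  calc _ ≤ (Real.exp (-2 * (φ * s ^ 2)) * Real.exp (-2 * (ψ * t ^ 2))) ^ (n * m) := by
        gcongr
    _ = Real.exp (-2 * (φ * m * s ^ 2 * n + ψ * n * t ^ 2 * m)) := by
        rw [← Real.exp_add, ← Real.exp_nat_mul]
        push_cast
        ring_nf
    _ ≤ _ := by
        refine Real.exp_le_exp.2 (mul_le_mul_of_nonpos_left ?_ (by norm_num))
        exact add_le_add (le_mul_of_one_le_right (by positivity) hn')
          (le_mul_of_one_le_right (by positivity) hm')
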